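/- Let F : ℋ → 𝒦 be a rigging operator and let H_0, H_1 be self-adjoint operators on ℋ with H_1 − H_0 = F*JF for some J ∈ ℬ_sa(𝒦). Then the off-axis scattering matrix S(z; H_1, H_0) = w(z; H_1, H_0)* w(z̄; H_1, H_0), for z = λ + iy with y > 0, and the scattering matrix S(λ; H_1, H_0) = w_+(λ; H_1, H_0)* w_−(λ; H_1, H_0), for λ ∈ Λ(H_0, F) ∩ Λ(H_1, F), both satisfy the stationary formula S(z; H_1, H_0) = 1 − 2i √(Im T_z(H_0)) J (1 − T_z(H_1) J) √(Im T_z(H_0)), where for the scattering matrix one puts z = λ on the left and z = λ + i0 on the right; consequently the norm limit S(λ+i0; H_1, H_0) exists and equals S(λ; H_1, H_0) ⊕ 1 on 𝒦 = 𝔥_λ(H_0) ⊕ 𝔥_λ(H_0)^⊥. -/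

import Mathlib

open MeasureTheory Filter Complex Set Topology
open scoped InnerProductSpace ComplexInnerProductSpace ENNReal Topology Real
set_option autoImplicit false

noncomputable section

namespace SSF

variable {𝓗 : Type*} {𝓚 : Type*}

section TraceClass

variable [NormedAddCommGroup 𝓗] [InnerProductSpace ℂ 𝓗]
variable [NormedAddCommGroup 𝓚] [InnerProductSpace ℂ 𝓚]

/-- A bounded operator `T` on a Hilbert space is trace class iff the sums
`∑ |⟪e i, T (f i)⟫|` over finite orthonormal families `e,f` are uniformly bounded. -/
def IsTraceClass (T : 𝓗 →L[ℂ] 𝓗) : Prop :=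
  ∃ C : ℝ, ∀ (n : ℕ) (e f : Fin n → 𝓗), Orthonormal ℂ e → Orthonormal ℂ f →
    ∑ i, ‖⟪e i, T (f i)⟫_ℂ‖ ≤ C

/-- The trace norm of a bounded operator: the supremum of `∑ |⟪e i, T (f i)⟫|` over
finite orthonormal families `e,f`. -/
def traceNorm (T : 𝓗 →L[ℂ] 𝓗) : ℝ :=
  sSup {c : ℝ | ∃ (n : ℕ) (e f : Fin n → 𝓗), Orthonormal ℂ e ∧ Orthonormal ℂ f ∧
    c = ∑ i, ‖⟪e i, T (f i)⟫_ℂ‖}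

/-- The trace of a bounded operator, computed in a Hilbert basis (meaningful for
trace class operators). -/
def trace [CompleteSpace 𝓗] (T : 𝓗 →L[ℂ] 𝓗) : ℂ :=
  ∑' i : (exists_hilbertBasis ℂ 𝓗).choose, ⟪(i : 𝓗), T (i : 𝓗)⟫_ℂ

/-- A bounded operator between Hilbert spaces is Hilbert-Schmidt iff the sums
`∑ ‖T (e i)‖ ^ 2` over finite orthonormal families are uniformly bounded. -/
def IsHilbertSchmidt (T : 𝓗 →L[ℂ] 𝓚) : Prop :=
  ∃ C : ℝ, ∀ (n : ℕ) (e : Fin n → 𝓗), Orthonormal ℂ e → ∑ i, ‖T (e i)‖ ^ 2 ≤ C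

end TraceClass

variable [NormedAddCommGroup 𝓗] [InnerProductSpace ℂ 𝓗] [CompleteSpace 𝓗]
variable [NormedAddCommGroup 𝓚] [InnerProductSpace ℂ 𝓚] [CompleteSpace 𝓚]

/-- A (possibly unbounded) self-adjoint operator on a Hilbert space, bundled together
with its resolvent `R_z = (H - z)⁻¹` at every nonreal `z`. -/
structure SelfAdjointOperator (𝓗 : Type*) [NormedAddCommGroup 𝓗]
    [InnerProductSpace ℂ 𝓗] [CompleteSpace 𝓗] where
  domain : Submodule ℂ 𝓗
  dense_domain : Dense (domain : Set 𝓗)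
  op : domain →ₗ[ℂ] 𝓗
  symmetric : ∀ f g : domain, ⟪op f, (g : 𝓗)⟫_ℂ = ⟪(f : 𝓗), op g⟫_ℂ
  resolvent : ℂ → (𝓗 →L[ℂ] 𝓗)
  resolvent_mem : ∀ z : ℂ, z.im ≠ 0 → ∀ f : 𝓗, resolvent z f ∈ domain
  resolvent_right : ∀ (z : ℂ) (hz : z.im ≠ 0) (f : 𝓗),
    op ⟨resolvent z f, resolvent_mem z hz f⟩ - z • resolvent z f = f
  resolvent_left : ∀ (z : ℂ), z.im ≠ 0 → ∀ g : domain,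
    resolvent z (op g - z • (g : 𝓗)) = (g : 𝓗)

/-- `IsSum H0 V H1` encodes the relation `H1 = H0 + V` for a bounded perturbation `V`,
via the second resolvent identity (which characterises it uniquely). -/
def IsSum (H0 : SelfAdjointOperator 𝓗) (V : 𝓗 →L[ℂ] 𝓗)
    (H1 : SelfAdjointOperator 𝓗) : Prop :=
  ∀ z : ℂ, z.im ≠ 0 →
    H1.resolvent z - H0.resolvent z = -(H1.resolvent z ∘L (V ∘L H0.resolvent z))

/-- Two self-adjoint operators are resolvent comparable if the difference of their
resolvents at some (hence any) nonreal point is trace class. -/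
def ResolventComparable (H0 H1 : SelfAdjointOperator 𝓗) : Prop :=
  ∃ z : ℂ, z.im ≠ 0 ∧ IsTraceClass (H1.resolvent z - H0.resolvent z)

/-- The spectral measure of a self-adjoint operator `H`, bundled with the associated
scalar spectral measures, the Borel functional calculus, and the decomposition into
absolutely continuous and singular parts. -/
structure SpectralMeasure (H : SelfAdjointOperator 𝓗) where
  proj : Set ℝ → (𝓗 →L[ℂ] 𝓗)
  proj_sa : ∀ s, IsSelfAdjoint (proj s)
  proj_mul : ∀ s t, proj (s ∩ t) = proj s ∘L proj t
  proj_univ : proj Set.univ = 1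
  scalar : 𝓗 → Measure ℝ
  scalar_finite : ∀ f, IsFiniteMeasure (scalar f)
  scalar_spec : ∀ (f : 𝓗) (s : Set ℝ), MeasurableSet s →
    (scalar f s).toReal = (⟪f, proj s f⟫_ℂ).re
  resolvent_spec : ∀ (z : ℂ), z.im ≠ 0 → ∀ f : 𝓗,
    ⟪f, H.resolvent z f⟫_ℂ = ∫ x : ℝ, ((x : ℂ) - z)⁻¹ ∂(scalar f)
  fc : (ℝ → ℂ) → (𝓗 →L[ℂ] 𝓗)
  fc_spec : ∀ (φ : ℝ → ℂ), Measurable φ → (∃ C, ∀ x, ‖φ x‖ ≤ C) →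
    ∀ f : 𝓗, ⟪f, fc φ f⟫_ℂ = ∫ x : ℝ, φ x ∂(scalar f)
  acProj : Set ℝ → (𝓗 →L[ℂ] 𝓗)
  sProj : Set ℝ → (𝓗 →L[ℂ] 𝓗)
  acProj_add_sProj : ∀ s, acProj s + sProj s = proj s
  acScalar : 𝓗 → Measure ℝ
  sScalar : 𝓗 → Measure ℝ
  acScalar_spec : ∀ (f : 𝓗) (s : Set ℝ), MeasurableSet s →
    (acScalar f s).toReal = (⟪f, acProj s f⟫_ℂ).re
  sScalar_spec : ∀ (f : 𝓗) (s : Set ℝ), MeasurableSet s →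
    (sScalar f s).toReal = (⟪f, sProj s f⟫_ℂ).re
  acScalar_ac : ∀ f, acScalar f ≪ MeasureTheory.volume
  sScalar_sing : ∀ f, (sScalar f).MutuallySingular MeasureTheory.volume

/-- The real-valued test function version of the functional calculus. -/
def SpectralMeasure.fcR {H : SelfAdjointOperator 𝓗} (E : SpectralMeasure H)
    (φ : ℝ → ℝ) : 𝓗 →L[ℂ] 𝓗 :=
  E.fc fun x => (φ x : ℂ)


/-- A rigging operator: a bounded operator with trivial kernel and dense range. -/
def IsRigging (F : 𝓗 →L[ℂ] 𝓚) : Prop :=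
  Function.Injective F ∧ Dense (Set.range F)

/-- The perturbation `F* J F` determined by a rigging `F` and a bounded operator `J`. -/
def sandwich (F : 𝓗 →L[ℂ] 𝓚) (J : 𝓚 →L[ℂ] 𝓚) : 𝓗 →L[ℂ] 𝓗 :=
  ContinuousLinearMap.adjoint F ∘L (J ∘L F)

/-- The sandwiched resolvent `T_z(H) = F R_z(H) F*`. -/
def Tz (F : 𝓗 →L[ℂ] 𝓚) (H : SelfAdjointOperator 𝓗) (z : ℂ) : 𝓚 →L[ℂ] 𝓚 :=
  F ∘L (H.resolvent z ∘L ContinuousLinearMap.adjoint F)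

/-- The imaginary part `Im T = (T - T*)/2i` of a bounded operator. -/
def imOp (T : 𝓚 →L[ℂ] 𝓚) : 𝓚 →L[ℂ] 𝓚 :=
  ((2 * Complex.I)⁻¹) • (T - ContinuousLinearMap.adjoint T)

/-- `Λ(H,F)`: the set of real points `l` at which the norm limit
`T_{l+i0}(H) = lim_{y→0⁺} T_{l+iy}(H)` exists. -/
def LambdaSet (F : 𝓗 →L[ℂ] 𝓚) (H : SelfAdjointOperator 𝓗) : Set ℝ :=
  {l : ℝ | ∃ L : 𝓚 →L[ℂ] 𝓚,
    Tendsto (fun y : ℝ => Tz F H ((l : ℂ) + y * Complex.I)) (𝓝[>] (0:ℝ)) (𝓝 L)}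

/-- The norm limit `T_{l+i0}(H)` (meaningful for `l ∈ Λ(H,F)`). -/
def Tlim (F : 𝓗 →L[ℂ] 𝓚) (H : SelfAdjointOperator 𝓗) (l : ℝ) : 𝓚 →L[ℂ] 𝓚 :=
  limUnder (𝓝[>] (0:ℝ)) (fun y : ℝ => Tz F H ((l : ℂ) + y * Complex.I))

/-- Convergence in trace norm along a filter. -/
def TendstoTraceNorm (f : ℝ → (𝓚 →L[ℂ] 𝓚)) (lf : Filter ℝ) (L : 𝓚 →L[ℂ] 𝓚) : Prop :=
  (∀ᶠ y in lf, IsTraceClass (f y - L)) ∧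
  Tendsto (fun y : ℝ => traceNorm (f y - L)) lf (𝓝 0)

/-- `Λ(H,F;𝓛₁)`: the set of points `l ∈ Λ(H,F)` at which additionally
`Im T_{l+i0}(H)` exists in trace class. -/
def LambdaSetTC (F : 𝓗 →L[ℂ] 𝓚) (H : SelfAdjointOperator 𝓗) : Set ℝ :=
  {l : ℝ | l ∈ LambdaSet F H ∧ ∃ M : 𝓚 →L[ℂ] 𝓚, IsTraceClass M ∧
    TendstoTraceNorm (fun y : ℝ => imOp (Tz F H ((l : ℂ) + y * Complex.I)))
      (𝓝[>] (0:ℝ)) M}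

/-- `F` is an `H`-Hilbert-Schmidt rigging operator. -/
def IsHSRigging (F : 𝓗 →L[ℂ] 𝓚) (H : SelfAdjointOperator 𝓗) : Prop :=
  IsRigging F ∧ ∃ z : ℂ, z.im ≠ 0 ∧ IsHilbertSchmidt (F ∘L H.resolvent z)

/-- The fibre Hilbert space `𝔥_λ(H)`: the closure of the range of
`Q = √(Im T_{λ+i0}(H))`. -/
def fibSpace (Q : 𝓚 →L[ℂ] 𝓚) : Submodule ℂ 𝓚 :=
  (LinearMap.range (Q : 𝓚 →ₗ[ℂ] 𝓚)).topologicalClosure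

/-- The element `Q ψ` of the fibre space. -/
def toFib (Q : 𝓚 →L[ℂ] 𝓚) (ψ : 𝓚) : fibSpace Q :=
  ⟨Q ψ, Submodule.le_topologicalClosure _ (LinearMap.mem_range_self _ ψ)⟩

/-- `Q`, corestricted to the fibre space. -/
def codToFib (Q : 𝓚 →L[ℂ] 𝓚) : 𝓚 →L[ℂ] (fibSpace Q) :=
  Q.codRestrict (fibSpace Q) fun ψ =>
    Submodule.le_topologicalClosure _ (LinearMap.mem_range_self _ ψ)

/-- `Q` is the positive square root of `Im T_{l+i0}(H)`. -/
def IsSqrtImT (F : 𝓗 →L[ℂ] 𝓚) (H : SelfAdjointOperator 𝓗) (l : ℝ)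
    (Q : 𝓚 →L[ℂ] 𝓚) : Prop :=
  IsSelfAdjoint Q ∧ (∀ ψ : 𝓚, 0 ≤ (⟪ψ, Q ψ⟫_ℂ).re) ∧ Q ∘L Q = imOp (Tlim F H l)

/-- The defining property of the wave matrix `w_±(l; H₁, H₀)` (`ε = 1` for `w₊`,
`ε = -1` for `w₋`), given positive square roots `Q₁, Q₀` of `Im T_{l+i0}(H₁)`,
`Im T_{l+i0}(H₀)`: it is a contraction `𝔥_l(H₀) → 𝔥_l(H₁)` determined by
`⟪𝔈_l(H₁)f, w_± 𝔈_l(H₀)g⟫ = lim_{y→0⁺} (y/π)⟪R_{l±iy}(H₁)f, R_{l±iy}(H₀)g⟫`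
for `f, g ∈ ran F*`. -/
def IsWaveMatrix (F : 𝓗 →L[ℂ] 𝓚) (H₁ H₀ : SelfAdjointOperator 𝓗)
    (Q₁ Q₀ : 𝓚 →L[ℂ] 𝓚) (l : ℝ) (ε : ℝ)
    (w : fibSpace Q₀ →L[ℂ] fibSpace Q₁) : Prop :=
  ‖w‖ ≤ 1 ∧ ∀ φ ψ : 𝓚,
    Tendsto (fun y : ℝ =>
        (y : ℂ) * ⟪H₁.resolvent ((l : ℂ) + (ε : ℂ) * y * Complex.I)
            (ContinuousLinearMap.adjoint F φ),
          H₀.resolvent ((l : ℂ) + (ε : ℂ) * y * Complex.I)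
            (ContinuousLinearMap.adjoint F ψ)⟫_ℂ)
      (𝓝[>] (0:ℝ)) (𝓝 ⟪Q₁ φ, ((w (toFib Q₀ ψ)) : 𝓚)⟫_ℂ)

/-- Pointwise application of an `L²` element (via its canonical representative). -/
def lpApply {μ : Measure ℝ} (g : MeasureTheory.Lp 𝓚 2 μ) (l : ℝ) : 𝓚 :=
  (g : ℝ →ₘ[μ] 𝓚) l

/-- `U` is the unitary factor in the polar decomposition `R_z(H)F* = U|R_z(H)F*|`:
`U` is unitary and `U*(R_z(H)F*)` is positive self-adjoint. -/
def IsPolarUnitary (F : 𝓗 →L[ℂ] 𝓚) (H : SelfAdjointOperator 𝓗) (z : ℂ)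
    (U : 𝓚 →L[ℂ] 𝓗) : Prop :=
  (∀ ψ : 𝓚, ‖U ψ‖ = ‖ψ‖) ∧ Function.Surjective U ∧
  IsSelfAdjoint (ContinuousLinearMap.adjoint U ∘L
    (H.resolvent z ∘L ContinuousLinearMap.adjoint F)) ∧
  ∀ ψ : 𝓚, 0 ≤ (⟪ψ, (ContinuousLinearMap.adjoint U ∘L
    (H.resolvent z ∘L ContinuousLinearMap.adjoint F)) ψ⟫_ℂ).re

/-- The off-axis scattering matrix `S(z; H₁, H₀) = w(z)* w(z̄)`, expressed through the
unitary polar factors `U_z(H₁), U_z(H₀), U_{z̄}(H₁), U_{z̄}(H₀)` via the off-axis wave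
matrices `w(z; H₁, H₀) = U_z(H₁)* U_z(H₀)`. -/
def offAxisScattering (U₀ U₁ : ℂ → (𝓚 →L[ℂ] 𝓗)) (z : ℂ) : 𝓚 →L[ℂ] 𝓚 :=
  ContinuousLinearMap.adjoint (ContinuousLinearMap.adjoint (U₁ z) ∘L U₀ z) ∘L
    (ContinuousLinearMap.adjoint (U₁ ((starRingEnd ℂ) z)) ∘L U₀ ((starRingEnd ℂ) z))

/-- The algebraic identity behind the stationary formula. -/
theorem stationary_ring_identity {R : Type*} [Ring R] {J T₀ T₁ T₀' T₁' : R}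
    (h : T₁ - T₀ = -(T₁ * J * T₀)) (h_comm : T₁ - T₀ = -(T₀ * J * T₁))
    (h' : T₁' - T₀' = -(T₀' * J * T₁')) :
    (1 + T₀' * J) * (T₁ - T₁') * (1 + J * T₀') =
      (T₀ - T₀') - (T₀ - T₀') * (J * ((1 - T₁ * J) * (T₀ - T₀'))) := by
  have e : T₁ * J * T₀ = T₀ - T₁ := by rw [← neg_sub T₁ T₀, h, neg_neg]
  have e_comm : T₀ * J * T₁ = T₀ - T₁ := by rw [← neg_sub T₁ T₀, h_comm, neg_neg]
  have e' : (1 + T₀' * J) * T₁' = T₀' := by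
    rw [add_mul, one_mul, ← neg_neg (T₀' * J * T₁'), ← h']; abel
  have right : (1 - T₁ * J) * (T₀ - T₀') = T₁ - T₀' + T₁ * J * T₀' := by
    calc (1 - T₁ * J) * (T₀ - T₀') = T₀ - T₁ * J * T₀ - T₀' + T₁ * J * T₀' := by noncomm_ring
      _ = _ := by rw [e]; abel
  have left : T₀ * (J * (T₁ - T₀' + T₁ * J * T₀')) = T₀ - T₁ - T₁ * J * T₀' := by
    calc T₀ * (J * (T₁ - T₀' + T₁ * J * T₀'))
        = T₀ * J * T₁ - T₀ * J * T₀' + T₀ * J * T₁ * J * T₀' := by noncomm_ring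
      _ = _ := by rw [e_comm]; noncomm_ring
  rw [mul_sub, e', right, sub_mul T₀ T₀', left]
  noncomm_ring

theorem imOp_eq_star (T : 𝓚 →L[ℂ] 𝓚) : imOp T = (2 * Complex.I)⁻¹ • (T - star T) := rfl

theorem two_I_smul_imOp (T : 𝓚 →L[ℂ] 𝓚) : (2 * Complex.I) • imOp T = T - star T := by
  rw [imOp_eq_star, smul_inv_smul₀ (by simp)]

theorem imOp_star (T : 𝓚 →L[ℂ] 𝓚) : imOp (star T) = -imOp T := by
  rw [imOp_eq_star, imOp_eq_star, star_star, ← smul_neg, neg_sub]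

theorem continuous_imOp : Continuous (imOp : (𝓚 →L[ℂ] 𝓚) → (𝓚 →L[ℂ] 𝓚)) :=
  (continuous_id.sub continuous_star).const_smul (2 * Complex.I)⁻¹

/-- The right-hand side of the stationary formula. -/
def stationary (Q J T : 𝓚 →L[ℂ] 𝓚) : 𝓚 →L[ℂ] 𝓚 :=
  1 - (2 * Complex.I) • (Q ∘L (J ∘L ((1 - T ∘L J) ∘L Q)))

theorem stationary_imOp_identity {J T₀ T₁ : 𝓚 →L[ℂ] 𝓚} (hJ : IsSelfAdjoint J)
    (h : T₁ - T₀ = -(T₁ * J * T₀)) (h_comm : T₁ - T₀ = -(T₀ * J * T₁)) :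
    (1 + star T₀ * J) * imOp T₁ * (1 + J * star T₀) =
      imOp T₀ - (2 * Complex.I) • (imOp T₀ * (J * ((1 - T₁ * J) * imOp T₀))) := by
  have h' : star T₁ - star T₀ = -(star T₀ * J * star T₁) := by
    rw [← star_sub, h]
    simp [hJ.star_eq, mul_assoc]
  have key := stationary_ring_identity h h_comm h'
  have h2 : (2 * Complex.I) ≠ 0 := by simp
  refine smul_right_injective _ h2 ?_
  simp only [← two_I_smul_imOp, mul_smul_comm, smul_mul_assoc] at key
  simp only [key, smul_sub]

/-- The sesquilinear form of the stationary formula on the range of `Q₀`. -/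
theorem inner_stationary {J T₀ T₁ Q₀ Q₁ : 𝓚 →L[ℂ] 𝓚} (hJ : IsSelfAdjoint J)
    (h : T₁ - T₀ = -(T₁ * J * T₀)) (h_comm : T₁ - T₀ = -(T₀ * J * T₁))
    (hQ₀ : IsSelfAdjoint Q₀) (hQ₁ : IsSelfAdjoint Q₁)
    (sq₀ : Q₀ * Q₀ = imOp T₀) (sq₁ : Q₁ * Q₁ = imOp T₁) (φ ψ : 𝓚) :
    ⟪Q₁ ((1 + J * T₀) φ), Q₁ ((1 + J * star T₀) ψ)⟫_ℂ =
      ⟪Q₀ φ, stationary Q₀ J T₁ (Q₀ ψ)⟫_ℂ := by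
  have move (A B : 𝓚 →L[ℂ] 𝓚) : ⟪A φ, B ψ⟫_ℂ = ⟪φ, (star A * B) ψ⟫_ℂ := by
    rw [mul_apply_eq_comp, ContinuousLinearMap.star_eq_adjoint,
      ContinuousLinearMap.adjoint_inner_right]
  have l := move (Q₁ * (1 + J * T₀)) (Q₁ * (1 + J * star T₀))
  have r := move Q₀ (stationary Q₀ J T₁ * Q₀)
  have e : star (Q₁ * (1 + J * T₀)) * (Q₁ * (1 + J * star T₀)) =
      star Q₀ * (stationary Q₀ J T₁ * Q₀) := by
    have key := stationary_imOp_identity hJ h h_comm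
    rw [← sq₀, ← sq₁] at key
    simp only [star_mul, star_add, star_one, hQ₁.star_eq, hQ₀.star_eq, hJ.star_eq]
    have hs : stationary Q₀ J T₁ = 1 - (2 * Complex.I) • (Q₀ * (J * ((1 - T₁ * J) * Q₀))) := rfl
    rw [hs]
    simp only [sub_mul, mul_sub, one_mul, mul_smul_comm, smul_mul_assoc, mul_assoc] at key ⊢
    exact key
  rw [e] at l
  exact l.trans r.symm

theorem SelfAdjointOperator.adjoint_resolvent (H : SelfAdjointOperator 𝓗) {z : ℂ}
    (hz : z.im ≠ 0) :
    ContinuousLinearMap.adjoint (H.resolvent z) = H.resolvent (starRingEnd ℂ z) := by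
  have hz' : (starRingEnd ℂ z).im ≠ 0 := by simpa using hz
  refine ContinuousLinearMap.ext fun g => ext_inner_left ℂ fun f => ?_
  rw [ContinuousLinearMap.adjoint_inner_right]
  conv_lhs => rw [← H.resolvent_right _ hz' g]
  conv_rhs => rw [← H.resolvent_right _ hz f]
  rw [inner_sub_left, inner_sub_right, inner_smul_left, inner_smul_right]
  congr 1
  exact (H.symmetric ⟨_, H.resolvent_mem z hz f⟩ ⟨_, H.resolvent_mem _ hz' g⟩).symm

theorem SelfAdjointOperator.resolvent_sub (H : SelfAdjointOperator 𝓗) {z w : ℂ}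
    (hz : z.im ≠ 0) (hw : w.im ≠ 0) :
    H.resolvent z - H.resolvent w = (z - w) • (H.resolvent z ∘L H.resolvent w) := by
  ext f
  have h := H.resolvent_left z hz ⟨_, H.resolvent_mem w hw f⟩
  have e : H.op ⟨_, H.resolvent_mem w hw f⟩ = f + w • H.resolvent w f :=
    sub_eq_iff_eq_add.mp (H.resolvent_right w hw f)
  simp only [e, map_sub, map_add, map_smul] at h
  simp only [sub_apply, smul_apply, ContinuousLinearMap.comp_apply, sub_smul]
  conv_lhs => rw [← h]
  abel

theorem SelfAdjointOperator.resolvent_injective (H : SelfAdjointOperator 𝓗) {z : ℂ}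
    (hz : z.im ≠ 0) : Function.Injective (H.resolvent z) := by
  intro f g hfg
  rw [← H.resolvent_right z hz f, ← H.resolvent_right z hz g]
  simp only [hfg]

theorem star_Tz (F : 𝓗 →L[ℂ] 𝓚) (H : SelfAdjointOperator 𝓗) {z : ℂ} (hz : z.im ≠ 0) :
    star (Tz F H z) = Tz F H (starRingEnd ℂ z) := by
  rw [ContinuousLinearMap.star_eq_adjoint, Tz, Tz, ContinuousLinearMap.adjoint_comp,
    ContinuousLinearMap.adjoint_comp, ContinuousLinearMap.adjoint_adjoint,
    H.adjoint_resolvent hz]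
  rfl

/-- `Im z |R_z(H) F*|² = Im T_z(H)`. -/
theorem im_smul_adjoint_comp_self (F : 𝓗 →L[ℂ] 𝓚) (H : SelfAdjointOperator 𝓗) {z : ℂ}
    (hz : z.im ≠ 0) :
    (z.im : ℂ) • (ContinuousLinearMap.adjoint (H.resolvent z ∘L ContinuousLinearMap.adjoint F) ∘L
      (H.resolvent z ∘L ContinuousLinearMap.adjoint F)) = imOp (Tz F H z) := by
  have hz' : (starRingEnd ℂ z).im ≠ 0 := by simpa using hz
  have hres := H.resolvent_sub hz' hz
  have hc : starRingEnd ℂ z - z = -(2 * Complex.I * z.im) := by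
    rw [← neg_sub, Complex.sub_conj]; push_cast; ring
  have h2 : (2 * Complex.I) ≠ 0 := by simp
  refine smul_right_injective _ h2 ?_
  simp only
  rw [two_I_smul_imOp, star_Tz F H hz, ContinuousLinearMap.adjoint_comp,
    ContinuousLinearMap.adjoint_adjoint, H.adjoint_resolvent hz, smul_smul]
  ext φ
  have := congrArg (fun A : 𝓗 →L[ℂ] 𝓗 => F (A (ContinuousLinearMap.adjoint F φ))) hres
  simp only [hc, sub_apply, smul_apply, ContinuousLinearMap.comp_apply, map_sub, map_smul] at this
  rw [neg_smul] at this
  simp only [Tz, sub_apply, smul_apply, ContinuousLinearMap.comp_apply]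
  rw [← neg_sub, this, neg_neg]

theorem nonneg_of_re_inner_nonneg {Q : 𝓚 →L[ℂ] 𝓚} (hQ : IsSelfAdjoint Q)
    (h : ∀ ψ : 𝓚, 0 ≤ (⟪ψ, Q ψ⟫_ℂ).re) : 0 ≤ Q := by
  rw [ContinuousLinearMap.nonneg_iff_isPositive]
  refine ⟨ContinuousLinearMap.isSelfAdjoint_iff_isSymmetric.mp hQ, fun ψ => ?_⟩
  have := h ψ
  rw [← inner_conj_symm, Complex.conj_re] at this
  exact this

theorem imOp_Tz_nonneg (F : 𝓗 →L[ℂ] 𝓚) (H : SelfAdjointOperator 𝓗) {z : ℂ}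
    (hz : 0 < z.im) : 0 ≤ imOp (Tz F H z) := by
  rw [← im_smul_adjoint_comp_self F H hz.ne', ContinuousLinearMap.nonneg_iff_isPositive]
  exact (ContinuousLinearMap.isPositive_adjoint_comp_self _).smul_of_nonneg
    (by exact_mod_cast hz.le)

/-- If `c ≥ 0` and `Q = √(c |R_z(H)F*|²)`, then `√c R_z(H)F* = U_z(H) Q`. -/
theorem IsPolarUnitary.sqrt_smul_eq {F : 𝓗 →L[ℂ] 𝓚} {H : SelfAdjointOperator 𝓗} {z : ℂ}
    {U : 𝓚 →L[ℂ] 𝓗} (hU : IsPolarUnitary F H z U) {c : ℝ} (hc : 0 ≤ c) {Q : 𝓚 →L[ℂ] 𝓚}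
    (hQ : 0 ≤ Q)
    (sq : (c : ℂ) • (ContinuousLinearMap.adjoint
      (H.resolvent z ∘L ContinuousLinearMap.adjoint F) ∘L
        (H.resolvent z ∘L ContinuousLinearMap.adjoint F)) = Q * Q) (φ : 𝓚) :
    (√c : ℂ) • H.resolvent z (ContinuousLinearMap.adjoint F φ) = U (Q φ) := by
  obtain ⟨iso, surj, sa, pos⟩ := hU
  set A := H.resolvent z ∘L ContinuousLinearMap.adjoint F
  set P := ContinuousLinearMap.adjoint U ∘L A with hP
  have UU : ContinuousLinearMap.adjoint U ∘L U = 1 :=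
    (ContinuousLinearMap.norm_map_iff_adjoint_comp_self U).mp iso
  have UP (x : 𝓚) : U (P x) = A x := by
    obtain ⟨ψ, hψ⟩ := surj (A x)
    have : P x = ψ := by
      rw [hP, ContinuousLinearMap.comp_apply, ← hψ, ← ContinuousLinearMap.comp_apply, UU]
      rfl
    rw [this, hψ]
  have PP : P * P = ContinuousLinearMap.adjoint A ∘L A := by
    have h : P * P = star P * P := by rw [sa.star_eq]
    rw [h, ContinuousLinearMap.star_eq_adjoint]
    ext x
    refine ext_inner_left ℂ fun y => ?_
    rw [mul_apply_eq_comp, ContinuousLinearMap.adjoint_inner_right,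
      ContinuousLinearMap.comp_apply (ContinuousLinearMap.adjoint A),
      ContinuousLinearMap.adjoint_inner_right, ← UP x, ← UP y]
    exact ((ContinuousLinearMap.inner_map_map_iff_adjoint_comp_self U).mpr UU _ _).symm
  have hP0 : 0 ≤ (√c : ℂ) • P := by
    rw [ContinuousLinearMap.nonneg_iff_isPositive]
    exact ((ContinuousLinearMap.nonneg_iff_isPositive _).mp
      (nonneg_of_re_inner_nonneg sa pos)).smul_of_nonneg (by exact_mod_cast Real.sqrt_nonneg c)
  have hPQ : (√c : ℂ) • P = Q := by
    have hsq : ((√c : ℂ) • P) * ((√c : ℂ) • P) = Q * Q := by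
      rw [smul_mul_smul_comm, PP, ← sq]
      congr 1
      exact_mod_cast Real.mul_self_sqrt hc
    rw [← CFC.sqrt_unique hsq hP0, CFC.sqrt_mul_self Q hQ]
  rw [← hPQ, smul_apply, map_smul, UP]
  rfl

theorem resolvent_adjoint_eq {F : 𝓗 →L[ℂ] 𝓚} {H₀ H₁ : SelfAdjointOperator 𝓗}
    {J : 𝓚 →L[ℂ] 𝓚} (hH : IsSum H₀ (sandwich F J) H₁) {z : ℂ} (hz : z.im ≠ 0) (φ : 𝓚) :
    H₀.resolvent z (ContinuousLinearMap.adjoint F φ) =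
      H₁.resolvent z (ContinuousLinearMap.adjoint F ((1 + J * Tz F H₀ z) φ)) := by
  have h := congrArg (fun A : 𝓗 →L[ℂ] 𝓗 => A (ContinuousLinearMap.adjoint F φ)) (hH z hz)
  simp only [sandwich, sub_apply, neg_apply, ContinuousLinearMap.comp_apply] at h
  simp only [Tz, add_apply, one_apply_eq_self, mul_apply_eq_comp,
    ContinuousLinearMap.comp_apply, map_add]
  rw [sub_eq_iff_eq_add] at h
  rw [h]; abel

theorem Tz_sub {F : 𝓗 →L[ℂ] 𝓚} {H₀ H₁ : SelfAdjointOperator 𝓗}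
    {J : 𝓚 →L[ℂ] 𝓚} (hH : IsSum H₀ (sandwich F J) H₁) {z : ℂ} (hz : z.im ≠ 0) :
    Tz F H₁ z - Tz F H₀ z = -(Tz F H₁ z * J * Tz F H₀ z) := by
  ext φ
  have h := congrArg F (resolvent_adjoint_eq hH hz φ)
  simp only [add_apply, one_apply_eq_self, map_add] at h
  simp only [Tz, sub_apply, neg_apply, mul_apply_eq_comp,
    ContinuousLinearMap.comp_apply] at h ⊢
  exact sub_eq_of_eq_add (by rw [neg_add_eq_sub]; exact eq_sub_of_add_eq h.symm)

theorem Tz_sub_comm {F : 𝓗 →L[ℂ] 𝓚} {H₀ H₁ : SelfAdjointOperator 𝓗}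
    {J : 𝓚 →L[ℂ] 𝓚} (hJ : IsSelfAdjoint J) (hH : IsSum H₀ (sandwich F J) H₁) {z : ℂ}
    (hz : z.im ≠ 0) :
    Tz F H₁ z - Tz F H₀ z = -(Tz F H₀ z * J * Tz F H₁ z) := by
  have h := congrArg star (Tz_sub hH (z := starRingEnd ℂ z) (by simpa using hz))
  simpa [← star_Tz F _ hz, hJ.star_eq, mul_assoc] using h

theorem IsPolarUnitary.adjoint_apply_self {F : 𝓗 →L[ℂ] 𝓚} {H : SelfAdjointOperator 𝓗} {z : ℂ}
    {U : 𝓚 →L[ℂ] 𝓗} (hU : IsPolarUnitary F H z U) (φ : 𝓚) :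
    ContinuousLinearMap.adjoint U (U φ) = φ :=
  congrArg (fun A : 𝓚 →L[ℂ] 𝓚 => A φ)
    ((ContinuousLinearMap.norm_map_iff_adjoint_comp_self U).mp hU.1)

/-- The off-axis wave matrix `w(z) = U_z(H₁)* U_z(H₀)` maps `Q₀ φ` to `Q₁ (1 + J T_z(H₀)) φ`. -/
theorem wave_apply {F : 𝓗 →L[ℂ] 𝓚} {H₀ H₁ : SelfAdjointOperator 𝓗}
    {J : 𝓚 →L[ℂ] 𝓚} (hH : IsSum H₀ (sandwich F J) H₁) {z : ℂ} (hz : z.im ≠ 0)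
    {U₀ U₁ : 𝓚 →L[ℂ] 𝓗} (hU₀ : IsPolarUnitary F H₀ z U₀) (hU₁ : IsPolarUnitary F H₁ z U₁)
    {c : ℝ} (hc : 0 ≤ c) {Q₀ Q₁ : 𝓚 →L[ℂ] 𝓚} (hQ₀ : 0 ≤ Q₀) (hQ₁ : 0 ≤ Q₁)
    (sq₀ : (c : ℂ) • (ContinuousLinearMap.adjoint
      (H₀.resolvent z ∘L ContinuousLinearMap.adjoint F) ∘L
        (H₀.resolvent z ∘L ContinuousLinearMap.adjoint F)) = Q₀ * Q₀)
    (sq₁ : (c : ℂ) • (ContinuousLinearMap.adjoint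
      (H₁.resolvent z ∘L ContinuousLinearMap.adjoint F) ∘L
        (H₁.resolvent z ∘L ContinuousLinearMap.adjoint F)) = Q₁ * Q₁) (φ : 𝓚) :
    ContinuousLinearMap.adjoint U₁ (U₀ (Q₀ φ)) = Q₁ ((1 + J * Tz F H₀ z) φ) := by
  rw [← hU₀.sqrt_smul_eq hc hQ₀ sq₀, resolvent_adjoint_eq hH hz,
    hU₁.sqrt_smul_eq hc hQ₁ sq₁, hU₁.adjoint_apply_self]

theorem adjoint_injective_of_isRigging {F : 𝓗 →L[ℂ] 𝓚} (hF : IsRigging F) :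
    Function.Injective (ContinuousLinearMap.adjoint F) := by
  rw [injective_iff_map_eq_zero]
  intro φ hφ
  refine hF.2.eq_zero_of_inner_left ℂ ?_
  rintro - ⟨f, rfl⟩
  rw [← ContinuousLinearMap.adjoint_inner_left, hφ, inner_zero_left]

/-- Cancellation of an injective self-adjoint operator on both sides. -/
theorem eq_of_inner_apply_eq {Q A B : 𝓚 →L[ℂ] 𝓚} (hQ : IsSelfAdjoint Q)
    (inj : Function.Injective Q) (h : ∀ φ ψ, ⟪Q φ, A (Q ψ)⟫_ℂ = ⟪Q φ, B (Q ψ)⟫_ℂ) : A = B := by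
  have sym (x y : 𝓚) : ⟪Q x, y⟫_ℂ = ⟪x, Q y⟫_ℂ := by
    rw [← ContinuousLinearMap.adjoint_inner_right, hQ.adjoint_eq]
  have hAB (ψ : 𝓚) : A (Q ψ) = B (Q ψ) :=
    inj (ext_inner_left ℂ fun φ => by rw [← sym, ← sym, h])
  have hstar : ContinuousLinearMap.adjoint A = ContinuousLinearMap.adjoint B := by
    ext v
    refine inj (ext_inner_left ℂ fun φ => ?_)
    rw [← sym, ← sym, ContinuousLinearMap.adjoint_inner_right,
      ContinuousLinearMap.adjoint_inner_right, hAB]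
  exact ContinuousLinearMap.adjoint.injective hstar

theorem offAxisScattering_eq_stationary {F : 𝓗 →L[ℂ] 𝓚} (hF : IsRigging F)
    {H₀ H₁ : SelfAdjointOperator 𝓗} {J : 𝓚 →L[ℂ] 𝓚} (hJ : IsSelfAdjoint J)
    (hH : IsSum H₀ (sandwich F J) H₁) {U₀ U₁ : ℂ → (𝓚 →L[ℂ] 𝓗)}
    (hU₀ : ∀ z : ℂ, z.im ≠ 0 → IsPolarUnitary F H₀ z (U₀ z))
    (hU₁ : ∀ z : ℂ, z.im ≠ 0 → IsPolarUnitary F H₁ z (U₁ z))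
    {z : ℂ} (hz : 0 < z.im) {Q : 𝓚 →L[ℂ] 𝓚} (hQ : 0 ≤ Q) (sq : Q * Q = imOp (Tz F H₀ z)) :
    offAxisScattering U₀ U₁ z = stationary Q J (Tz F H₁ z) := by
  have hz' : (starRingEnd ℂ z).im ≠ 0 := by simpa using hz.ne'
  have hQ₁ : 0 ≤ CFC.sqrt (imOp (Tz F H₁ z)) := CFC.sqrt_nonneg _
  have sq₁ : CFC.sqrt (imOp (Tz F H₁ z)) * CFC.sqrt (imOp (Tz F H₁ z)) = imOp (Tz F H₁ z) :=
    CFC.sqrt_mul_sqrt_self _ (imOp_Tz_nonneg F H₁ hz)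
  generalize CFC.sqrt (imOp (Tz F H₁ z)) = Q₁ at hQ₁ sq₁
  have conj_sq {H : SelfAdjointOperator 𝓗} {P : 𝓚 →L[ℂ] 𝓚} (h : P * P = imOp (Tz F H z)) :
      (z.im : ℂ) • (ContinuousLinearMap.adjoint
        (H.resolvent (starRingEnd ℂ z) ∘L ContinuousLinearMap.adjoint F) ∘L
          (H.resolvent (starRingEnd ℂ z) ∘L ContinuousLinearMap.adjoint F)) = P * P := by
    have e := im_smul_adjoint_comp_self F H hz'
    rw [← star_Tz F H hz.ne', imOp_star, ← h, Complex.conj_im, Complex.ofReal_neg, neg_smul] at e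
    exact neg_injective e
  refine eq_of_inner_apply_eq hQ.isSelfAdjoint ?_ fun φ ψ => ?_
  · rw [injective_iff_map_eq_zero]
    intro φ hφ
    have h := (hU₀ z hz.ne').sqrt_smul_eq hz.le hQ
      ((im_smul_adjoint_comp_self F H₀ hz.ne').trans sq.symm) φ
    rw [hφ, map_zero] at h
    have hne : (√z.im : ℂ) ≠ 0 := by exact_mod_cast (Real.sqrt_pos.mpr hz).ne'
    have h0 := (smul_eq_zero.mp h).resolve_left hne
    refine adjoint_injective_of_isRigging hF (H₀.resolvent_injective hz.ne' ?_)
    rw [h0, map_zero, map_zero]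
  · rw [← inner_stationary hJ (Tz_sub hH hz.ne') (Tz_sub_comm hJ hH hz.ne')
      hQ.isSelfAdjoint hQ₁.isSelfAdjoint sq sq₁, star_Tz F H₀ hz.ne',
      ← wave_apply hH hz.ne' (hU₀ z hz.ne') (hU₁ z hz.ne') hz.le hQ hQ₁
        ((im_smul_adjoint_comp_self F H₀ hz.ne').trans sq.symm)
        ((im_smul_adjoint_comp_self F H₁ hz.ne').trans sq₁.symm),
      ← wave_apply hH hz' (hU₀ _ hz') (hU₁ _ hz') hz.le hQ hQ₁ (conj_sq sq) (conj_sq sq₁)]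
    rw [offAxisScattering, ContinuousLinearMap.comp_apply,
      ContinuousLinearMap.adjoint_inner_right, ContinuousLinearMap.comp_apply,
      ContinuousLinearMap.comp_apply]

theorem tendsto_Tlim {F : 𝓗 →L[ℂ] 𝓚} {H : SelfAdjointOperator 𝓗} {l : ℝ}
    (hl : l ∈ LambdaSet F H) :
    Tendsto (fun y : ℝ => Tz F H ((l : ℂ) + y * Complex.I)) (𝓝[>] (0:ℝ)) (𝓝 (Tlim F H l)) :=
  tendsto_nhds_limUnder hl

theorem add_mul_I_im (l y : ℝ) : ((l : ℂ) + y * Complex.I).im = y := by simp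

theorem Tlim_sub {F : 𝓗 →L[ℂ] 𝓚} {H₀ H₁ : SelfAdjointOperator 𝓗}
    {J : 𝓚 →L[ℂ] 𝓚} (hH : IsSum H₀ (sandwich F J) H₁) {l : ℝ}
    (h₀ : l ∈ LambdaSet F H₀) (h₁ : l ∈ LambdaSet F H₁) :
    Tlim F H₁ l - Tlim F H₀ l = -(Tlim F H₁ l * J * Tlim F H₀ l) := by
  refine tendsto_nhds_unique ((tendsto_Tlim h₁).sub (tendsto_Tlim h₀))
    ((((tendsto_Tlim h₁).mul_const J).mul (tendsto_Tlim h₀)).neg.congr' ?_)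
  filter_upwards [self_mem_nhdsWithin] with y hy
  exact (Tz_sub hH (by rw [add_mul_I_im]; exact (Set.mem_Ioi.mp hy).ne')).symm

theorem Tlim_sub_comm {F : 𝓗 →L[ℂ] 𝓚} {H₀ H₁ : SelfAdjointOperator 𝓗}
    {J : 𝓚 →L[ℂ] 𝓚} (hJ : IsSelfAdjoint J) (hH : IsSum H₀ (sandwich F J) H₁) {l : ℝ}
    (h₀ : l ∈ LambdaSet F H₀) (h₁ : l ∈ LambdaSet F H₁) :
    Tlim F H₁ l - Tlim F H₀ l = -(Tlim F H₀ l * J * Tlim F H₁ l) := by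
  refine tendsto_nhds_unique ((tendsto_Tlim h₁).sub (tendsto_Tlim h₀))
    ((((tendsto_Tlim h₀).mul_const J).mul (tendsto_Tlim h₁)).neg.congr' ?_)
  filter_upwards [self_mem_nhdsWithin] with y hy
  exact (Tz_sub_comm hJ hH (by rw [add_mul_I_im]; exact (Set.mem_Ioi.mp hy).ne')).symm

theorem tendsto_imOp_Tz {F : 𝓗 →L[ℂ] 𝓚} {H : SelfAdjointOperator 𝓗} {l : ℝ}
    (hl : l ∈ LambdaSet F H) :
    Tendsto (fun y : ℝ => imOp (Tz F H ((l : ℂ) + y * Complex.I))) (𝓝[>] (0:ℝ))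
      (𝓝 (imOp (Tlim F H l))) :=
  (continuous_imOp.tendsto _).comp (tendsto_Tlim hl)

theorem IsSqrtImT.nonneg {F : 𝓗 →L[ℂ] 𝓚} {H : SelfAdjointOperator 𝓗} {l : ℝ}
    {Q : 𝓚 →L[ℂ] 𝓚} (hQ : IsSqrtImT F H l Q) : 0 ≤ Q :=
  nonneg_of_re_inner_nonneg hQ.1 hQ.2.1

theorem tendsto_sqrt_imOp_Tz {F : 𝓗 →L[ℂ] 𝓚} {H : SelfAdjointOperator 𝓗} {l : ℝ}
    (hl : l ∈ LambdaSet F H) {Q : 𝓚 →L[ℂ] 𝓚} (hQ : IsSqrtImT F H l Q) :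
    Tendsto (fun y : ℝ => CFC.sqrt (imOp (Tz F H ((l : ℂ) + y * Complex.I)))) (𝓝[>] (0:ℝ))
      (𝓝 Q) := by
  have sq : Q * Q = imOp (Tlim F H l) := hQ.2.2
  have h0 : 0 ≤ imOp (Tlim F H l) := by
    rw [← sq]
    exact hQ.1.mul_self_nonneg
  rw [← CFC.sqrt_unique sq hQ.nonneg]
  refine (CFC.continuousOn_sqrt.continuousWithinAt h0).tendsto.comp
    (tendsto_nhdsWithin_iff.mpr ⟨tendsto_imOp_Tz hl, ?_⟩)
  filter_upwards [self_mem_nhdsWithin] with y hy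
  exact imOp_Tz_nonneg F H (by rw [add_mul_I_im]; exact hy)

/-- The norm limit of the off-axis scattering matrix. -/
theorem tendsto_offAxisScattering {F : 𝓗 →L[ℂ] 𝓚} (hF : IsRigging F)
    {H₀ H₁ : SelfAdjointOperator 𝓗} {J : 𝓚 →L[ℂ] 𝓚} (hJ : IsSelfAdjoint J)
    (hH : IsSum H₀ (sandwich F J) H₁) {U₀ U₁ : ℂ → (𝓚 →L[ℂ] 𝓗)}
    (hU₀ : ∀ z : ℂ, z.im ≠ 0 → IsPolarUnitary F H₀ z (U₀ z))
    (hU₁ : ∀ z : ℂ, z.im ≠ 0 → IsPolarUnitary F H₁ z (U₁ z))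
    {l : ℝ} (h₀ : l ∈ LambdaSet F H₀) (h₁ : l ∈ LambdaSet F H₁)
    {Q : 𝓚 →L[ℂ] 𝓚} (hQ : IsSqrtImT F H₀ l Q) :
    Tendsto (fun y : ℝ => offAxisScattering U₀ U₁ ((l : ℂ) + y * Complex.I)) (𝓝[>] (0:ℝ))
      (𝓝 (stationary Q J (Tlim F H₁ l))) := by
  have hQt := tendsto_sqrt_imOp_Tz h₀ hQ
  have hlim := ((hQt.mul ((((tendsto_Tlim h₁).mul_const J).const_sub 1).mul hQt |>.const_mul
    J)).const_smul (2 * Complex.I)).const_sub 1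
  refine hlim.congr' ?_
  filter_upwards [self_mem_nhdsWithin] with y hy
  have hz : 0 < ((l : ℂ) + y * Complex.I).im := by rw [add_mul_I_im]; exact hy
  exact (offAxisScattering_eq_stationary hF hJ hH hU₀ hU₁ hz (CFC.sqrt_nonneg _)
    (CFC.sqrt_mul_sqrt_self _ (imOp_Tz_nonneg F H₀ hz))).symm

/-- Elements of `fibSpace Q` are determined by their inner products with the range of `Q`. -/
theorem eq_of_mem_fibSpace {Q : 𝓚 →L[ℂ] 𝓚} {u v : 𝓚} (hu : u ∈ fibSpace Q)
    (hv : v ∈ fibSpace Q) (h : ∀ φ, ⟪Q φ, u⟫_ℂ = ⟪Q φ, v⟫_ℂ) : u = v := by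
  have hclosed : u - v ∈ (fibSpace Q)ᗮ := by
    rw [fibSpace, Submodule.orthogonal_closure, Submodule.mem_orthogonal]
    rintro - ⟨φ, rfl⟩
    rw [inner_sub_right, sub_eq_zero]
    exact h φ
  exact sub_eq_zero.mp (inner_self_eq_zero.mp
    ((Submodule.mem_orthogonal _ _).mp hclosed _ ((fibSpace Q).sub_mem hu hv)))

/-- The value of a wave matrix on the range of `Q₀`, where `T` is the limit of
`T_{l ± iy}(H₀)`. -/
theorem IsWaveMatrix.apply_toFib {F : 𝓗 →L[ℂ] 𝓚} {H₀ H₁ : SelfAdjointOperator 𝓗}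
    {J : 𝓚 →L[ℂ] 𝓚} (hH : IsSum H₀ (sandwich F J) H₁) {l : ℝ}
    (h₁ : l ∈ LambdaSet F H₁) {Q₀ Q₁ : 𝓚 →L[ℂ] 𝓚} (hQ₁ : IsSqrtImT F H₁ l Q₁)
    {ε : ℝ} (hε : ε = 1 ∨ ε = -1) {w : fibSpace Q₀ →L[ℂ] fibSpace Q₁}
    (hw : IsWaveMatrix F H₁ H₀ Q₁ Q₀ l ε w) {T : 𝓚 →L[ℂ] 𝓚}
    (hT : Tendsto (fun y : ℝ => Tz F H₀ ((l : ℂ) + (ε : ℂ) * y * Complex.I)) (𝓝[>] (0:ℝ)) (𝓝 T))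
    (ψ : 𝓚) : (w (toFib Q₀ ψ) : 𝓚) = Q₁ ((1 + J * T) ψ) := by
  refine eq_of_mem_fibSpace (w (toFib Q₀ ψ)).2 (toFib Q₁ _).2 fun φ => ?_
  refine tendsto_nhds_unique (hw.2 φ ψ) ?_
  have hlim : Tendsto (fun y : ℝ => ⟪φ, (imOp (Tz F H₁ ((l : ℂ) + y * Complex.I)) *
      (1 + J * Tz F H₀ ((l : ℂ) + (ε : ℂ) * y * Complex.I))) ψ⟫_ℂ) (𝓝[>] (0:ℝ))
      (𝓝 ⟪φ, (imOp (Tlim F H₁ l) * (1 + J * T)) ψ⟫_ℂ) := by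
    have hop := (tendsto_imOp_Tz h₁).mul ((hT.const_mul J).const_add 1)
    have hcont : Continuous fun A : 𝓚 →L[ℂ] 𝓚 => ⟪φ, A ψ⟫_ℂ := by fun_prop
    exact (hcont.tendsto _).comp hop
  have e : ⟪φ, (imOp (Tlim F H₁ l) * (1 + J * T)) ψ⟫_ℂ =
      ⟪Q₁ φ, ((toFib Q₁ ((1 + J * T) ψ) : fibSpace Q₁) : 𝓚)⟫_ℂ := by
    rw [← hQ₁.2.2, mul_apply_eq_comp, ContinuousLinearMap.comp_apply,
      ← ContinuousLinearMap.adjoint_inner_left, hQ₁.1.adjoint_eq]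
    rfl
  rw [e] at hlim
  refine hlim.congr' ?_
  filter_upwards [self_mem_nhdsWithin] with y hy
  have hy0 : y ≠ 0 := (Set.mem_Ioi.mp hy).ne'
  have him : ((l : ℂ) + (ε : ℂ) * y * Complex.I).im = ε * y := by simp
  have hz : ((l : ℂ) + (ε : ℂ) * y * Complex.I).im ≠ 0 := by
    rw [him]; rcases hε with rfl | rfl <;> simpa using hy0
  have hsq : (y : ℂ) • (ContinuousLinearMap.adjoint
      (H₁.resolvent ((l : ℂ) + (ε : ℂ) * y * Complex.I) ∘L ContinuousLinearMap.adjoint F) ∘L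
        (H₁.resolvent ((l : ℂ) + (ε : ℂ) * y * Complex.I) ∘L ContinuousLinearMap.adjoint F)) =
      imOp (Tz F H₁ ((l : ℂ) + y * Complex.I)) := by
    have h := im_smul_adjoint_comp_self F H₁ hz
    rw [him] at h
    rcases hε with rfl | rfl
    · simpa using h
    · have hconj : starRingEnd ℂ ((l : ℂ) + y * Complex.I) =
          (l : ℂ) + ((-1 : ℝ) : ℂ) * y * Complex.I := by simp
      rw [← hconj, ← star_Tz F H₁ (by rwa [add_mul_I_im]), imOp_star, neg_one_mul,
        Complex.ofReal_neg, neg_smul] at h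
      rw [← hconj]
      exact neg_injective h
  rw [← hsq, resolvent_adjoint_eq hH hz, mul_apply_eq_comp, smul_apply,
    inner_smul_right, ContinuousLinearMap.comp_apply, ContinuousLinearMap.adjoint_inner_right]
  rfl

theorem stationary_apply_mem_fibSpace {Q J T : 𝓚 →L[ℂ] 𝓚} {u : 𝓚} (hu : u ∈ fibSpace Q) :
    stationary Q J T u ∈ fibSpace Q :=
  (fibSpace Q).sub_mem hu ((fibSpace Q).smul_mem _ (toFib Q _).2)

theorem stationary_apply_of_mem_orthogonal {Q J T : 𝓚 →L[ℂ] 𝓚} (hQ : IsSelfAdjoint Q) {v : 𝓚}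
    (hv : v ∈ (fibSpace Q)ᗮ) : stationary Q J T v = v := by
  have h : Q v = 0 := by
    refine ext_inner_left ℂ fun φ => ?_
    rw [← ContinuousLinearMap.adjoint_inner_left, hQ.adjoint_eq, inner_zero_right]
    exact (Submodule.mem_orthogonal _ _).mp hv _ (toFib Q φ).2
  simp [stationary, h]

/-- The stationary formula for the scattering matrix `S = w₊* w₋`. -/
theorem stationary_apply_eq_scattering {F : 𝓗 →L[ℂ] 𝓚} {H₀ H₁ : SelfAdjointOperator 𝓗}
    {J : 𝓚 →L[ℂ] 𝓚} (hJ : IsSelfAdjoint J) (hH : IsSum H₀ (sandwich F J) H₁) {l : ℝ}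
    (h₀ : l ∈ LambdaSet F H₀) (h₁ : l ∈ LambdaSet F H₁) {Q₀ Q₁ : 𝓚 →L[ℂ] 𝓚}
    (hQ₀ : IsSqrtImT F H₀ l Q₀) (hQ₁ : IsSqrtImT F H₁ l Q₁)
    {wp wm : fibSpace Q₀ →L[ℂ] fibSpace Q₁}
    (hwp : IsWaveMatrix F H₁ H₀ Q₁ Q₀ l 1 wp) (hwm : IsWaveMatrix F H₁ H₀ Q₁ Q₀ l (-1) wm)
    {S : fibSpace Q₀ →L[ℂ] fibSpace Q₀}
    (hS : ∀ u v : fibSpace Q₀, ⟪(wp u : 𝓚), (wm v : 𝓚)⟫_ℂ = ⟪(u : 𝓚), (S v : 𝓚)⟫_ℂ)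
    (u : fibSpace Q₀) : stationary Q₀ J (Tlim F H₁ l) (u : 𝓚) = S u := by
  have hplus : Tendsto (fun y : ℝ => Tz F H₀ ((l : ℂ) + ((1 : ℝ) : ℂ) * y * Complex.I))
      (𝓝[>] (0:ℝ)) (𝓝 (Tlim F H₀ l)) := by
    simpa using tendsto_Tlim h₀
  have hminus : Tendsto (fun y : ℝ => Tz F H₀ ((l : ℂ) + ((-1 : ℝ) : ℂ) * y * Complex.I))
      (𝓝[>] (0:ℝ)) (𝓝 (star (Tlim F H₀ l))) := by
    refine (tendsto_Tlim h₀).star.congr' ?_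
    filter_upwards [self_mem_nhdsWithin] with y hy
    rw [star_Tz F H₀ (by rw [add_mul_I_im]; exact (Set.mem_Ioi.mp hy).ne')]
    congr 1
    simp
  have on_range (ψ : 𝓚) :
      stationary Q₀ J (Tlim F H₁ l) (toFib Q₀ ψ : 𝓚) = S (toFib Q₀ ψ) := by
    refine eq_of_mem_fibSpace (stationary_apply_mem_fibSpace (toFib Q₀ ψ).2)
      (S (toFib Q₀ ψ)).2 fun φ => ?_
    have h := hS (toFib Q₀ φ) (toFib Q₀ ψ)
    rw [hwp.apply_toFib hH h₁ hQ₁ (Or.inl rfl) hplus,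
      hwm.apply_toFib hH h₁ hQ₁ (Or.inr rfl) hminus,
      inner_stationary hJ (Tlim_sub hH h₀ h₁) (Tlim_sub_comm hJ hH h₀ h₁) hQ₀.1 hQ₁.1
        hQ₀.2.2 hQ₁.2.2] at h
    exact h
  have hdense : DenseRange (toFib Q₀) := by
    intro v
    rw [Topology.IsInducing.subtypeVal.closure_eq_preimage_closure_image, ← Set.range_comp]
    exact v.2
  have hfun : (fun v : fibSpace Q₀ => stationary Q₀ J (Tlim F H₁ l) (v : 𝓚)) =
      fun v => (S v : 𝓚) :=
    hdense.equalizer (by fun_prop) (by fun_prop) (funext on_range)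
  exact congrFun hfun u

/-- For `H₁ − H₀ = F*JF`, the off-axis scattering matrix
`S(z; H₁, H₀) = w(z)*w(z̄)` (for `Im z > 0`) and the scattering matrix
`S(l; H₁, H₀) = w₊(l)* w₋(l)` (for `l ∈ Λ(H₀,F) ∩ Λ(H₁,F)`) both satisfy the
stationary formula `S = 1 − 2i √(Im T(H₀)) J (1 − T(H₁)J) √(Im T(H₀))`; consequently
the norm limit `S(l+i0; H₁, H₀)` exists and equals `S(l; H₁, H₀) ⊕ 1` on
`𝒦 = 𝔥_l(H₀) ⊕ 𝔥_l(H₀)^⊥`. -/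
theorem scattering_matrix_stationary_formula
    (𝓗 𝓚 : Type) [NormedAddCommGroup 𝓗] [InnerProductSpace ℂ 𝓗] [CompleteSpace 𝓗]
    [NormedAddCommGroup 𝓚] [InnerProductSpace ℂ 𝓚] [CompleteSpace 𝓚]
    (F : 𝓗 →L[ℂ] 𝓚) (hF : IsRigging F)
    (H₀ H₁ : SelfAdjointOperator 𝓗)
    (J : 𝓚 →L[ℂ] 𝓚) (hJ : IsSelfAdjoint J) (hH : IsSum H₀ (sandwich F J) H₁)
    -- the unitary polar factors of `R_z(H₀)F*` and `R_z(H₁)F*`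
    (U₀ U₁ : ℂ → (𝓚 →L[ℂ] 𝓗))
    (hU₀ : ∀ z : ℂ, z.im ≠ 0 → IsPolarUnitary F H₀ z (U₀ z))
    (hU₁ : ∀ z : ℂ, z.im ≠ 0 → IsPolarUnitary F H₁ z (U₁ z)) :
    -- the off-axis stationary formula, `Im z > 0`
    (∀ z : ℂ, 0 < z.im → ∀ Qz : 𝓚 →L[ℂ] 𝓚,
      IsSelfAdjoint Qz → (∀ ψ : 𝓚, 0 ≤ (⟪ψ, Qz ψ⟫_ℂ).re) →
      Qz ∘L Qz = imOp (Tz F H₀ z) →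
      offAxisScattering U₀ U₁ z
        = 1 - (2 * Complex.I) • (Qz ∘L (J ∘L ((1 - Tz F H₁ z ∘L J) ∘L Qz)))) ∧
    -- the on-axis stationary formula and the limit `S(l+i0) = S(l) ⊕ 1`
    (∀ l : ℝ, l ∈ LambdaSet F H₀ → l ∈ LambdaSet F H₁ →
      ∀ Q₀ Q₁ : 𝓚 →L[ℂ] 𝓚, IsSqrtImT F H₀ l Q₀ → IsSqrtImT F H₁ l Q₁ →
      ∀ wp wm : fibSpace Q₀ →L[ℂ] fibSpace Q₁,
        IsWaveMatrix F H₁ H₀ Q₁ Q₀ l 1 wp → IsWaveMatrix F H₁ H₀ Q₁ Q₀ l (-1) wm →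
      ∀ S : fibSpace Q₀ →L[ℂ] fibSpace Q₀,
        -- `S` is the scattering matrix `w₊* w₋`
        (∀ (u v : fibSpace Q₀),
          ⟪((wp u : 𝓚)), ((wm v : 𝓚))⟫_ℂ = ⟪((u : 𝓚)), ((S v : 𝓚))⟫_ℂ) →
        -- stationary formula for `S(l; H₁, H₀)`
        (∀ u : fibSpace Q₀,
          ((S u : 𝓚)) = (u : 𝓚) -
            (2 * Complex.I) • (Q₀ (J ((1 - Tlim F H₁ l ∘L J) (Q₀ (u : 𝓚)))))) ∧
        -- the norm limit of the off-axis scattering matrix exists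
        Tendsto (fun y : ℝ => offAxisScattering U₀ U₁ ((l : ℂ) + y * Complex.I))
          (𝓝[>] (0:ℝ))
          (𝓝 (1 - (2 * Complex.I) •
            (Q₀ ∘L (J ∘L ((1 - Tlim F H₁ l ∘L J) ∘L Q₀))))) ∧
        -- and the limit acts as `S(l)` on `𝔥_l(H₀)` and as `1` on `𝔥_l(H₀)^⊥`
        (∀ u : fibSpace Q₀,
          (1 - (2 * Complex.I) • (Q₀ ∘L (J ∘L ((1 - Tlim F H₁ l ∘L J) ∘L Q₀))))
            ((u : 𝓚)) = ((S u : 𝓚))) ∧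
        (∀ v : 𝓚, v ∈ (fibSpace Q₀)ᗮ →
          (1 - (2 * Complex.I) • (Q₀ ∘L (J ∘L ((1 - Tlim F H₁ l ∘L J) ∘L Q₀)))) v
            = v)) := by
  refine ⟨fun z hz Q hQ pos sq => offAxisScattering_eq_stationary hF hJ hH hU₀ hU₁ hz
    (nonneg_of_re_inner_nonneg hQ pos) sq, ?_⟩
  intro l h₀ h₁ Q₀ Q₁ hQ₀ hQ₁ wp wm hwp hwm S hS
  have hSt := stationary_apply_eq_scattering hJ hH h₀ h₁ hQ₀ hQ₁ hwp hwm hS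
  exact ⟨fun u => (hSt u).symm, tendsto_offAxisScattering hF hJ hH hU₀ hU₁ h₀ h₁ hQ₀, hSt,
    fun v hv => stationary_apply_of_mem_orthogonal hQ₀.1 hv⟩

end SSF
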